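/- arXiv:1306.0063 — 5 statements merged into one kernel-verified Lean document; each statement's English description precedes it below -/
import Mathlib

section
/- Let n be a positive natural number, H : ℝⁿ → ℝ a Hamiltonian function, and T : ℝⁿ → ℝⁿ a bijection that is differentiable at a point z with invertible derivative DT(z), and whose inverse T⁻¹ is differentiable at T(z) with derivative (DT(z))⁻¹. Define the forward acceptance probability α(z) = min{1, exp(-H(T z))/exp(-H(z)) · |det DT(z)|} and the reverse acceptance probability β(T z) = min{1, exp(-H(z))/exp(-H(T z)) · |det D(T⁻¹)(T z)|}. Then the detailed balance condition with determinant adjustment holds pointwise: α(z) · exp(-H(z)) = β(T z) · exp(-H(T z)) · |det DT(z)|. -/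
/-- Both sides of the Metropolis balance equation are `min b (a * d)`. -/
lemma metropolis_balance {a b d : ℝ} (ha : 0 < a) (hb : 0 < b) (hd : 0 < d) :
    min 1 (a / b * d) * b = min 1 (b / a * d⁻¹) * a * d := by
  rw [mul_assoc, min_mul_of_nonneg _ _ hb.le, min_mul_of_nonneg _ _ (mul_pos ha hd).le,
    one_mul, one_mul, min_comm]
  congr 1 <;> field_simp

/-- **Detailed Balance Condition with determinant adjustment** (pointwise form).
If `T` is a bijective integrator, differentiable at `z` with invertible derivative `DT`,
whose inverse is differentiable at `T z` with derivative `DT⁻¹`, then the forward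
acceptance probability `α(z) = min {1, exp(-H(Tz))/exp(-H z) * |det DT|}` and reverse
acceptance probability `β(Tz) = min {1, exp(-H z)/exp(-H (Tz)) * |det D(T⁻¹)(Tz)|}`
satisfy `α(z) exp(-H z) = β(T z) exp(-H (T z)) |det DT|`. -/
theorem detailed_balance_determinant_adjustment
    (n : ℕ) (hn : 0 < n)
    (H : EuclideanSpace ℝ (Fin n) → ℝ)
    (T : EuclideanSpace ℝ (Fin n) → EuclideanSpace ℝ (Fin n))
    (hT : Function.Bijective T)
    (z : EuclideanSpace ℝ (Fin n))
    (DT : EuclideanSpace ℝ (Fin n) ≃L[ℝ] EuclideanSpace ℝ (Fin n))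
    (hderiv : HasFDerivAt T
      (DT : EuclideanSpace ℝ (Fin n) →L[ℝ] EuclideanSpace ℝ (Fin n)) z)
    (hinvderiv : HasFDerivAt (Function.invFun T)
      (DT.symm : EuclideanSpace ℝ (Fin n) →L[ℝ] EuclideanSpace ℝ (Fin n)) (T z)) :
    min 1 (Real.exp (-H (T z)) / Real.exp (-H z) *
        |(DT : EuclideanSpace ℝ (Fin n) →L[ℝ] EuclideanSpace ℝ (Fin n)).det|) *
      Real.exp (-H z)
    = min 1 (Real.exp (-H z) / Real.exp (-H (T z)) *
        |(DT.symm : EuclideanSpace ℝ (Fin n) →L[ℝ] EuclideanSpace ℝ (Fin n)).det|) *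
      Real.exp (-H (T z)) *
      |(DT : EuclideanSpace ℝ (Fin n) →L[ℝ] EuclideanSpace ℝ (Fin n)).det| := by
  rw [ContinuousLinearEquiv.det_coe_symm, abs_inv]
  exact metropolis_balance (Real.exp_pos _) (Real.exp_pos _)
    (abs_pos.mpr DT.toLinearEquiv.isUnit_det'.ne_zero)
end

section
/- Let D be a positive natural number, θ̂₁, θ̂₂ ∈ ℝᴰ with θ̂₁ ≠ θ̂₂, and v* = (θ̂₂ - θ̂₁)/‖θ̂₂ - θ̂₁‖. Then the vicinity function V(θ) = ⟨θ - θ̂₁, θ - θ̂₂⟩ + |⟨θ - θ̂₁, v*⟩|·|⟨θ - θ̂₂, v*⟩| satisfies V(θ) ≥ 0 for all θ ∈ ℝᴰ, and V(θ) = 0 for every θ on the line segment {θ̂₁ + t(θ̂₂ - θ̂₁) : t ∈ [0,1]}. -/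
open scoped RealInnerProductSpace

/-- For a unit vector `u`, the inner product of two vectors `a` and `a - c • u` that differ by a
multiple of `u` splits into the squared distance of `a` from the line `ℝ u` and the product of the
coordinates along `u`. -/
theorem inner_add_abs_mul_abs_of_norm_eq_one {E : Type*} [NormedAddCommGroup E]
    [InnerProductSpace ℝ E] {u : E} (hu : ‖u‖ = 1) (a : E) (c : ℝ) :
    ⟪a, a - c • u⟫ + |⟪a, u⟫| * |⟪a - c • u, u⟫| =
      (‖a‖ ^ 2 - ⟪a, u⟫ ^ 2) +
        (⟪a, u⟫ * (⟪a, u⟫ - c) + |⟪a, u⟫ * (⟪a, u⟫ - c)|) := by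
  rw [← abs_mul, inner_sub_left, inner_sub_right, real_inner_smul_left, real_inner_smul_right,
    real_inner_self_eq_norm_sq, real_inner_self_eq_norm_sq, hu, one_pow, mul_one]
  ring

/-- The vicinity function
`V(θ) = ⟨θ - θ̂₁, θ - θ̂₂⟩ + |⟨θ - θ̂₁, v*⟩| |⟨θ - θ̂₂, v*⟩|` is nonnegative everywhere
and vanishes on the line segment between the modes `θ̂₁` and `θ̂₂`. -/
theorem vicinity_function_nonneg
    (D : ℕ) (hD : 0 < D)
    (θhat₁ θhat₂ : EuclideanSpace ℝ (Fin D)) (hne : θhat₁ ≠ θhat₂)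
    (vstar : EuclideanSpace ℝ (Fin D))
    (hvstar : vstar = ‖θhat₂ - θhat₁‖⁻¹ • (θhat₂ - θhat₁))
    (V : EuclideanSpace ℝ (Fin D) → ℝ)
    (hV : ∀ θ, V θ = ⟪θ - θhat₁, θ - θhat₂⟫ +
      |⟪θ - θhat₁, vstar⟫| * |⟪θ - θhat₂, vstar⟫|) :
    (∀ θ, 0 ≤ V θ) ∧
      ∀ t : ℝ, t ∈ Set.Icc (0:ℝ) 1 → V (θhat₁ + t • (θhat₂ - θhat₁)) = 0 := by
  have hd : ‖θhat₂ - θhat₁‖ ≠ 0 := norm_ne_zero_iff.mpr (sub_ne_zero.mpr hne.symm)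
  have hu : ‖vstar‖ = 1 := by
    rw [hvstar, norm_smul, norm_inv, norm_norm, inv_mul_cancel₀ hd]
  have hsmul : θhat₂ - θhat₁ = ‖θhat₂ - θhat₁‖ • vstar := by
    rw [hvstar, smul_inv_smul₀ hd]
  set c := ‖θhat₂ - θhat₁‖
  have hV' : ∀ θ, V θ = (‖θ - θhat₁‖ ^ 2 - ⟪θ - θhat₁, vstar⟫ ^ 2) +
      (⟪θ - θhat₁, vstar⟫ * (⟪θ - θhat₁, vstar⟫ - c) +
        |⟪θ - θhat₁, vstar⟫ * (⟪θ - θhat₁, vstar⟫ - c)|) := by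
    intro θ
    have hb : θ - θhat₂ = (θ - θhat₁) - c • vstar := by
      rw [← hsmul]
      abel
    rw [hV, hb, inner_add_abs_mul_abs_of_norm_eq_one hu]
  refine ⟨fun θ => ?_, fun t ht => ?_⟩
  · rw [hV']
    refine add_nonneg (sub_nonneg.mpr ?_) (add_abs_nonneg _)
    have h := abs_real_inner_le_norm (θ - θhat₁) vstar
    rw [hu, mul_one] at h
    exact sq_le_sq.mpr (by rwa [abs_norm])
  · have hx : ⟪(t * c) • vstar, vstar⟫ = t * c := by
      rw [real_inner_smul_left, real_inner_self_eq_norm_sq, hu, one_pow, mul_one]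
    have hneg : t * c * (t * c - c) ≤ 0 := by
      have h : 0 ≤ t * (1 - t) * c ^ 2 :=
        mul_nonneg (mul_nonneg ht.1 (sub_nonneg.mpr ht.2)) (sq_nonneg c)
      linarith
    rw [hV', add_sub_cancel_left, hsmul, smul_smul, hx, norm_smul, hu, mul_one, Real.norm_eq_abs,
      sq_abs, abs_of_nonpos hneg]
    ring
end

section
/- Let D be a positive natural number, θ̂₁, θ̂₂ ∈ ℝᴰ with θ̂₁ ≠ θ̂₂, and v* = (θ̂₂ - θ̂₁)/‖θ̂₂ - θ̂₁‖. Suppose θ ∈ ℝᴰ satisfies ⟨θ - θ̂₁, v*⟩ · ⟨θ - θ̂₂, v*⟩ ≤ 0 (i.e., θ lies between the two hyperplanes through θ̂₁ and θ̂₂ normal to v*). Then the vicinity function V(θ) = ⟨θ - θ̂₁, θ - θ̂₂⟩ + |⟨θ - θ̂₁, v*⟩|·|⟨θ - θ̂₂, v*⟩| equals the squared Euclidean distance from θ to the line through θ̂₁ and θ̂₂, namely V(θ) = ‖(θ - θ̂₁) - ⟨θ - θ̂₁, v*⟩ v*‖². -/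
open scoped RealInnerProductSpace

/-- If `θ` lies between the two hyperplanes through `θ̂₁` and `θ̂₂` normal to `v*`
(i.e. `⟨θ - θ̂₁, v*⟩ ⟨θ - θ̂₂, v*⟩ ≤ 0`), then the vicinity function
`V(θ) = ⟨θ - θ̂₁, θ - θ̂₂⟩ + |⟨θ - θ̂₁, v*⟩| |⟨θ - θ̂₂, v*⟩|` equals the squared
Euclidean distance from `θ` to the line through `θ̂₁` and `θ̂₂`. -/
theorem vicinity_function_distance_to_line
    (D : ℕ) (hD : 0 < D)
    (θhat₁ θhat₂ : EuclideanSpace ℝ (Fin D)) (hne : θhat₁ ≠ θhat₂)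
    (vstar : EuclideanSpace ℝ (Fin D))
    (hvstar : vstar = ‖θhat₂ - θhat₁‖⁻¹ • (θhat₂ - θhat₁))
    (V : EuclideanSpace ℝ (Fin D) → ℝ)
    (hV : ∀ ϑ, V ϑ = ⟪ϑ - θhat₁, ϑ - θhat₂⟫ +
      |⟪ϑ - θhat₁, vstar⟫| * |⟪ϑ - θhat₂, vstar⟫|)
    (θ : EuclideanSpace ℝ (Fin D))
    (hθ : ⟪θ - θhat₁, vstar⟫ * ⟪θ - θhat₂, vstar⟫ ≤ 0) :
    V θ = ‖(θ - θhat₁) - ⟪θ - θhat₁, vstar⟫ • vstar‖ ^ 2 := by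
  have hL : ‖θhat₂ - θhat₁‖ ≠ 0 := norm_ne_zero_iff.mpr (sub_ne_zero.mpr hne.symm)
  have hnorm : ‖vstar‖ = 1 := by
    rw [hvstar, norm_smul, norm_inv, norm_norm, inv_mul_cancel₀ hL]
  have hself : ⟪vstar, vstar⟫ = 1 := by
    rw [real_inner_self_eq_norm_sq, hnorm, one_pow]
  have hdiff : θ - θhat₂ = (θ - θhat₁) - ‖θhat₂ - θhat₁‖ • vstar := by
    rw [hvstar, smul_inv_smul₀ hL]
    abel
  rw [hV, ← abs_mul, abs_of_nonpos hθ, hdiff, norm_sub_sq_real, norm_smul, hnorm]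
  simp only [inner_sub_left, inner_sub_right, real_inner_smul_left, real_inner_smul_right,
    hself, ← real_inner_self_eq_norm_sq, mul_one, Real.norm_eq_abs, sq_abs]
  ring
end

section
/- Let D be a positive natural number, ε > 0 a step size, w ∈ ℝᴰ a fixed vector, and f : ℝᴰ → ℝᴰ a differentiable map. Suppose φ : ℝᴰ → ℝᴰ is differentiable and satisfies the implicit generalized-leapfrog position update φ(θ) = θ + ε·w + (ε/2)·(f(θ) + f(φ(θ))) for all θ, and suppose that at a point θ the linear map I - (ε/2)·Df(φ(θ)) is invertible. Then the derivative of φ at θ is Dφ(θ) = (I - (ε/2)·Df(φ(θ)))⁻¹ ∘ (I + (ε/2)·Df(θ)). -/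
/-- For the implicit generalized-leapfrog position update
`φ(θ) = θ + ε w + (ε/2)(f(θ) + f(φ(θ)))`, if `I - (ε/2) Df(φ(θ))` is invertible at a
point `θ`, then `Dφ(θ) = (I - (ε/2) Df(φ(θ)))⁻¹ ∘ (I + (ε/2) Df(θ))`. -/
theorem generalized_leapfrog_jacobian
    (D : ℕ) (hD : 0 < D)
    (ε : ℝ) (hε : 0 < ε)
    (w : EuclideanSpace ℝ (Fin D))
    (f φ : EuclideanSpace ℝ (Fin D) → EuclideanSpace ℝ (Fin D))
    (hf : Differentiable ℝ f) (hφ : Differentiable ℝ φ)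
    (heq : ∀ ϑ, φ ϑ = ϑ + ε • w + (ε / 2) • (f ϑ + f (φ ϑ)))
    (θ : EuclideanSpace ℝ (Fin D))
    (A : EuclideanSpace ℝ (Fin D) ≃L[ℝ] EuclideanSpace ℝ (Fin D))
    (hA : (A : EuclideanSpace ℝ (Fin D) →L[ℝ] EuclideanSpace ℝ (Fin D))
      = 1 - (ε / 2) • fderiv ℝ f (φ θ)) :
    fderiv ℝ φ θ
      = (A.symm : EuclideanSpace ℝ (Fin D) →L[ℝ] EuclideanSpace ℝ (Fin D)).comp
        (1 + (ε / 2) • fderiv ℝ f θ) := by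
  have h_rhs : HasFDerivAt φ
      (ContinuousLinearMap.id ℝ (EuclideanSpace ℝ (Fin D)) +
        (ε / 2) • (fderiv ℝ f θ + (fderiv ℝ f (φ θ)).comp (fderiv ℝ φ θ))) θ := by
    have hcomp := (hf (φ θ)).hasFDerivAt.comp θ (hφ θ).hasFDerivAt
    have h := ((hasFDerivAt_id θ).add_const (ε • w)).add
      (((hf θ).hasFDerivAt.add hcomp).const_smul (ε / 2))
    exact h.congr_of_eventuallyEq (Filter.Eventually.of_forall heq)
  have h_fderiv := h_rhs.fderiv
  ext1 x
  have hx : fderiv ℝ φ θ x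
      = x + (ε / 2) • (fderiv ℝ f θ x + fderiv ℝ f (φ θ) (fderiv ℝ φ θ x)) :=
    DFunLike.congr_fun h_fderiv x
  have hAx : A (fderiv ℝ φ θ x)
      = fderiv ℝ φ θ x - (ε / 2) • fderiv ℝ f (φ θ) (fderiv ℝ φ θ x) :=
    DFunLike.congr_fun hA (fderiv ℝ φ θ x)
  change fderiv ℝ φ θ x = A.symm (x + (ε / 2) • fderiv ℝ f θ x)
  rw [ContinuousLinearEquiv.eq_symm_apply, hAx, sub_eq_iff_eq_add, add_assoc, ← smul_add]
  exact hx
end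

section
/- Let π and q be functions from a set Θ to the positive reals, and let c > 0. For θ_t, θ_{t+1} ∈ Θ define T(θ_{t+1}|θ_t) = q(θ_{t+1})·min{1, (π(θ_{t+1})/q(θ_{t+1}))/(π(θ_t)/q(θ_t))}, S(θ_t) = min{1, c/(π(θ_t)/q(θ_t))}, and Q(θ_{t+1}) = q(θ_{t+1})·min{1, (π(θ_{t+1})/q(θ_{t+1}))/c}. Then the minorization inequality T(θ_{t+1}|θ_t) ≥ S(θ_t)·Q(θ_{t+1}) holds for all θ_t, θ_{t+1} ∈ Θ. -/
theorem min_one_div_mul_min_one_div_le {a b c : ℝ} (ha : 0 < a) (hb : 0 ≤ b) (hc : 0 < c) :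
    min 1 (c / a) * min 1 (b / c) ≤ min 1 (b / a) := by
  have hbc : 0 ≤ min 1 (b / c) := le_min zero_le_one (by positivity)
  refine le_min (mul_le_one₀ (min_le_left _ _) hbc (min_le_left _ _)) ?_
  calc min 1 (c / a) * min 1 (b / c) ≤ c / a * (b / c) :=
        mul_le_mul (min_le_right _ _) (min_le_right _ _) hbc (by positivity)
    _ = b / a := by field_simp

/-- **Minorization inequality for the regeneration construction.** With target density
`p`, proposal density `q` (both positive), and constant `c > 0`, the independence
Metropolis transition kernel `T(θ'|θ) = q(θ') min{1, (p(θ')/q(θ'))/(p(θ)/q(θ))}`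
dominates the product `S(θ) Q(θ')` of the mixing coefficient
`S(θ) = min{1, c/(p(θ)/q(θ))}` and the independence kernel
`Q(θ') = q(θ') min{1, (p(θ')/q(θ'))/c}`. -/
theorem regeneration_minorization
    (Θ : Type*) (p q : Θ → ℝ)
    (hp : ∀ θ, 0 < p θ) (hq : ∀ θ, 0 < q θ)
    (c : ℝ) (hc : 0 < c)
    (T : Θ → Θ → ℝ) (S : Θ → ℝ) (Q : Θ → ℝ)
    (hT : ∀ θt θt1, T θt θt1 = q θt1 * min 1 ((p θt1 / q θt1) / (p θt / q θt)))
    (hS : ∀ θt, S θt = min 1 (c / (p θt / q θt)))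
    (hQ : ∀ θt1, Q θt1 = q θt1 * min 1 ((p θt1 / q θt1) / c)) :
    ∀ θt θt1, S θt * Q θt1 ≤ T θt θt1 := by
  intro θt θt1
  rw [hS, hQ, hT, mul_left_comm]
  exact mul_le_mul_of_nonneg_left
    (min_one_div_mul_min_one_div_le (div_pos (hp θt) (hq θt)) (div_pos (hp θt1) (hq θt1)).le hc)
    (hq θt1).le
end
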